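/- (Step (a) in the proof of Lemma 4.3, uniform version.) Let Ω ⊂ ℝ^N be a bounded domain, p > 1 and K a compact subset of W^{1,p}_0(Ω). Then for every ε > 0 there exists ρ_ε = ρ(K, ε) > 0 such that ∫_{Ω^u_{ρ_ε}} |∇u|^p dx < ε for all u ∈ K, where Ω^u_ρ = {x ∈ Ω : |u(x)| < ρ}. -/

import Mathlib

open MeasureTheory Filter Set

noncomputable section

abbrev EN (N : ℕ) := EuclideanSpace ℝ (Fin N)

/-- The ambient Banach space `L^p(Ω) × L^p(Ω; ℝ^N)` in which `W^{1,p}_0(Ω)` is realized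
as pairs `(u, ∇u)`. -/
abbrev WAmbient (N : ℕ) (p : ℝ) (Ω : Set (EN N)) :=
  Lp ℝ (ENNReal.ofReal p) (volume.restrict Ω) ×
    Lp (EN N) (ENNReal.ofReal p) (volume.restrict Ω)

/-- The Sobolev space `W^{1,p}_0(Ω)`, realized as the closure, in `L^p × L^p`, of the set
of pairs `(φ, ∇φ)` with `φ` smooth and compactly supported in `Ω`. -/
def WSpace (N : ℕ) (p : ℝ) (Ω : Set (EN N)) [Fact (1 ≤ ENNReal.ofReal p)] :
    Set (WAmbient N p Ω) :=
  closure {w : WAmbient N p Ω | ∃ φ : EN N → ℝ, ContDiff ℝ (⊤ : ℕ∞) φ ∧ HasCompactSupport φ ∧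
    tsupport φ ⊆ Ω ∧ (⇑w.1 =ᵐ[volume.restrict Ω] φ) ∧
    (⇑w.2 =ᵐ[volume.restrict Ω] fun x => gradient φ x)}

open scoped Topology RealInnerProductSpace

lemma aux_ibp {N : ℕ} {Ω : Set (EN N)} (hΩ : MeasurableSet Ω) {φ ψ : EN N → ℝ}
    (hφ : ContDiff ℝ (⊤ : ℕ∞) φ) (hφc : HasCompactSupport φ) (hφΩ : tsupport φ ⊆ Ω)
    (hψ : ContDiff ℝ (⊤ : ℕ∞) ψ) (hψc : HasCompactSupport ψ) {δ : ℝ} (hδ : 0 < δ) (v : EN N) :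
    |∫ x in Ω, (1 + (φ x / δ) ^ 2)⁻¹ * ⟪gradient φ x, v⟫ * ψ x|
      ≤ δ * ((Real.pi / 2) * ∫ x, ‖fderiv ℝ ψ x v‖) := by
  have hφd : Differentiable ℝ φ := hφ.differentiable (by simp)
  have hψd : Differentiable ℝ ψ := hψ.differentiable (by simp)
  set f : EN N → ℝ := fun x => δ * Real.arctan (φ x / δ) with hf
  have hfC : ContDiff ℝ (⊤ : ℕ∞) f :=
    contDiff_const.mul (Real.contDiff_arctan.comp (hφ.div_const δ))
  have hfd : ∀ x, fderiv ℝ f x v = (1 + (φ x / δ) ^ 2)⁻¹ * ⟪gradient φ x, v⟫ := by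
    intro x
    have h1 : HasFDerivAt (fun x => φ x / δ) (δ⁻¹ • fderiv ℝ φ x) x := by
      simpa [div_eq_mul_inv] using (hφd x).hasFDerivAt.mul_const δ⁻¹
    have h2 := (h1.arctan).const_mul δ
    have h3 : fderiv ℝ f x = _ := h2.fderiv
    have h4 : ⟪gradient φ x, v⟫ = fderiv ℝ φ x v := by
      rw [gradient, InnerProductSpace.toDual_symm_apply]
    rw [h3, h4]
    simp
    field_simp
  have hfc : HasCompactSupport f := by
    apply hφc.comp_left (g := fun t => δ * Real.arctan (t / δ))
    simp
  have cψ' : Continuous fun x => fderiv ℝ ψ x v :=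
    (hψ.continuous_fderiv (by simp)).clm_apply continuous_const
  have cf' : Continuous fun x => fderiv ℝ f x v :=
    (hfC.continuous_fderiv (by simp)).clm_apply continuous_const
  have sψ' : HasCompactSupport fun x => fderiv ℝ ψ x v :=
    (hψc.fderiv ℝ).comp_left (g := fun L : EN N →L[ℝ] ℝ => L v) (by simp)
  have ibp := integral_mul_fderiv_eq_neg_fderiv_mul_of_integrable (μ := (volume : Measure (EN N)))
    (f := f) (g := ψ) (v := v)
    ((cf'.mul hψ.continuous).integrable_of_hasCompactSupport hψc.mul_left)
    ((hfC.continuous.mul cψ').integrable_of_hasCompactSupport sψ'.mul_left)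
    ((hfC.continuous.mul hψ.continuous).integrable_of_hasCompactSupport hψc.mul_left)
    (fun x _ => (hfC.differentiable (by simp)) x) (fun x _ => hψd x)
  have e1 : ∫ x in Ω, (1 + (φ x / δ) ^ 2)⁻¹ * ⟪gradient φ x, v⟫ * ψ x
      = ∫ x, fderiv ℝ f x v * ψ x := by
    simp_rw [← hfd]
    apply setIntegral_eq_integral_of_forall_compl_eq_zero
    intro x hx
    have : fderiv ℝ φ x = 0 := by
      by_contra h
      exact hx (hφΩ (support_fderiv_subset ℝ h))
    rw [hfd, gradient, this]
    simp
  rw [e1, ← abs_neg, ← ibp]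
  have : |∫ x, f x * fderiv ℝ ψ x v| ≤ ∫ x, (δ * (Real.pi / 2)) * ‖fderiv ℝ ψ x v‖ := by
    rw [← Real.norm_eq_abs]
    apply norm_integral_le_of_norm_le
    · exact ((cψ'.integrable_of_hasCompactSupport sψ').norm).const_mul _
    · refine ae_of_all _ fun x => ?_
      rw [norm_mul]
      gcongr
      rw [hf, norm_mul, Real.norm_eq_abs, abs_of_pos hδ]
      gcongr
      rw [Real.norm_eq_abs, abs_le]
      exact ⟨(Real.neg_pi_div_two_lt_arctan _).le, (Real.arctan_lt_pi_div_two _).le⟩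
  rw [integral_const_mul] at this
  linarith

lemma aux_Lp {α E : Type*} [MeasurableSpace α] {μ : Measure α} [NormedAddCommGroup E]
    {p : ℝ} (hp : 1 < p) [Fact (1 ≤ ENNReal.ofReal p)]
    {W : ℕ → Lp E (ENNReal.ofReal p) μ} {w : Lp E (ENNReal.ofReal p) μ}
    (h : Tendsto W atTop (𝓝 w)) :
    Tendsto (fun n => ∫ x, ‖W n x - w x‖ ^ p ∂μ) atTop (𝓝 0) := by
  have hp0 : 0 < p := by linarith
  have h1 : ∀ n, ∫ x, ‖W n x - w x‖ ^ p ∂μ = ‖W n - w‖ ^ p := by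
    intro n
    have hm := (Lp.memLp (W n - w)).eLpNorm_eq_integral_rpow_norm
      (by simpa using hp0) (by simp)
    rw [ENNReal.toReal_ofReal hp0.le] at hm
    have hi : 0 ≤ ∫ x, ‖(W n - w) x‖ ^ p ∂μ := integral_nonneg fun x => by positivity
    rw [Lp.norm_def, hm, ENNReal.toReal_ofReal (by positivity), Real.rpow_inv_rpow hi hp0.ne']
    apply integral_congr_ae
    filter_upwards [Lp.coeFn_sub (W n) w] with x hx
    rw [hx]; rfl
  simp_rw [h1]
  have h2 : Tendsto (fun n => ‖W n - w‖) atTop (𝓝 0) := tendsto_iff_norm_sub_tendsto_zero.1 h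
  simpa [Real.zero_rpow hp0.ne'] using h2.rpow_const (p := p) (Or.inr hp0.le)

lemma aux_L1 {α E : Type*} [MeasurableSpace α] {μ : Measure α} [IsFiniteMeasure μ]
    [NormedAddCommGroup E]
    {p : ℝ} [Fact (1 ≤ ENNReal.ofReal p)]
    {W : ℕ → Lp E (ENNReal.ofReal p) μ} {w : Lp E (ENNReal.ofReal p) μ}
    (h : Tendsto W atTop (𝓝 w)) :
    Tendsto (fun n => ∫ x, ‖W n x - w x‖ ∂μ) atTop (𝓝 0) := by
  have h1 := (Lp.tendsto_Lp_iff_tendsto_eLpNorm' _ _).mp h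
  have hc : μ Set.univ ^ (1 / (1 : ENNReal).toReal - 1 / (ENNReal.ofReal p).toReal) ≠ ⊤ := by
    apply ENNReal.rpow_ne_top_of_nonneg _ (measure_ne_top _ _)
    have h1p := (Fact.out : 1 ≤ ENNReal.ofReal p)
    have : 1 ≤ (ENNReal.ofReal p).toReal := by
      simpa using ENNReal.toReal_mono (by simp) h1p
    simp only [ENNReal.toReal_one, div_one, sub_nonneg]
    rw [div_le_one (by linarith)]
    exact this
  have h2 : Tendsto (fun n => eLpNorm (⇑(W n) - ⇑w) 1 μ) atTop (𝓝 0) := by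
    refine tendsto_of_tendsto_of_tendsto_of_le_of_le tendsto_const_nhds
      (h := fun n => eLpNorm (⇑(W n) - ⇑w) (ENNReal.ofReal p) μ *
        μ Set.univ ^ (1 / (1 : ENNReal).toReal - 1 / (ENNReal.ofReal p).toReal)) ?_
      (fun _ => zero_le) (fun n => eLpNorm_le_eLpNorm_mul_rpow_measure_univ Fact.out
        ((Lp.aestronglyMeasurable _).sub (Lp.aestronglyMeasurable _)))
    simpa using ENNReal.Tendsto.mul_const h1 (Or.inr hc)
  have h3 := (ENNReal.tendsto_toReal ENNReal.zero_ne_top).comp h2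
  refine h3.congr fun n => ?_
  rw [Function.comp_apply, eLpNorm_one_eq_lintegral_enorm]
  exact (integral_norm_eq_lintegral_enorm (f := ⇑(W n) - ⇑w)
      ((Lp.aestronglyMeasurable _).sub (Lp.aestronglyMeasurable _))).symm

lemma aux_theta_le (t δ : ℝ) : ‖(1 + (t / δ) ^ 2)⁻¹‖ ≤ 1 := by
  rw [Real.norm_eq_abs, abs_of_nonneg (by positivity)]
  exact inv_le_one_of_one_le₀ (by nlinarith [sq_nonneg (t / δ)])

lemma aux_limit {N : ℕ} {Ω : Set (EN N)} (hΩ : MeasurableSet Ω)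
    [IsFiniteMeasure (volume.restrict Ω)]
    {p : ℝ} [Fact (1 ≤ ENNReal.ofReal p)] {w : WAmbient N p Ω} (hw : w ∈ WSpace N p Ω)
    {ψ : EN N → ℝ} (hψ : ContDiff ℝ (⊤ : ℕ∞) ψ) (hψc : HasCompactSupport ψ)
    {δ : ℝ} (hδ : 0 < δ) (v : EN N) :
    |∫ x in Ω, (1 + (w.1 x / δ) ^ 2)⁻¹ * ⟪w.2 x, v⟫ * ψ x|
      ≤ δ * ((Real.pi / 2) * ∫ x, ‖fderiv ℝ ψ x v‖) := by
  obtain ⟨W, hWmem, hW⟩ := mem_closure_iff_seq_limit.1 hw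
  have hW1 : Tendsto (fun n => (W n).1) atTop (𝓝 w.1) := (continuous_fst.tendsto _).comp hW
  have hW2 : Tendsto (fun n => (W n).2) atTop (𝓝 w.2) := (continuous_snd.tendsto _).comp hW
  obtain ⟨ns, hns, hae⟩ := (tendstoInMeasure_of_tendsto_Lp hW1).exists_seq_tendsto_ae
  have hL1 := aux_L1 (hW2.comp hns.tendsto_atTop)
  obtain ⟨M, hM⟩ := hψc.exists_bound_of_continuous hψ.continuous
  have hM0 : 0 ≤ M := (norm_nonneg _).trans (hM 0)
  have hint : ∀ g : Lp (EN N) (ENNReal.ofReal p) (volume.restrict Ω),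
      Integrable g (volume.restrict Ω) := fun g => (Lp.memLp g).integrable Fact.out
  have hmeasθ : ∀ u : Lp ℝ (ENNReal.ofReal p) (volume.restrict Ω),
      Measurable (fun x => (1 + (u x / δ) ^ 2)⁻¹) := fun u =>
    (((Lp.stronglyMeasurable u).measurable.div_const δ).pow_const 2 |>.const_add 1).inv
  have hmeas : ∀ (u : Lp ℝ (ENNReal.ofReal p) (volume.restrict Ω))
      (g : EN N → EN N), AEStronglyMeasurable g (volume.restrict Ω) →
      AEStronglyMeasurable (fun x => (1 + (u x / δ) ^ 2)⁻¹ * ⟪g x, v⟫ * ψ x)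
        (volume.restrict Ω) := fun u g hg =>
    ((hmeasθ u).aestronglyMeasurable.mul (hg.inner_const)).mul
      hψ.continuous.aestronglyMeasurable
  have hbd : ∀ (t : ℝ) (z : EN N) (x : EN N),
      ‖(1 + (t / δ) ^ 2)⁻¹ * ⟪z, v⟫ * ψ x‖ ≤ ‖v‖ * M * ‖z‖ := by
    intro t z x
    rw [norm_mul, norm_mul]
    calc _ ≤ 1 * (‖z‖ * ‖v‖) * M := by
          gcongr
          · exact aux_theta_le t δ
          · exact norm_inner_le_norm _ _
          · exact hM x
      _ = _ := by ring
  -- the limit of the second part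
  have hB : Tendsto (fun n => ∫ x in Ω, (1 + ((W (ns n)).1 x / δ) ^ 2)⁻¹ * ⟪w.2 x, v⟫ * ψ x) atTop
      (𝓝 (∫ x in Ω, (1 + (w.1 x / δ) ^ 2)⁻¹ * ⟪w.2 x, v⟫ * ψ x)) := by
    apply tendsto_integral_of_dominated_convergence (fun x => ‖v‖ * M * ‖w.2 x‖)
    · exact fun n => hmeas _ _ (Lp.aestronglyMeasurable _)
    · exact (hint _).norm.const_mul _
    · exact fun n => ae_of_all _ fun x => hbd _ _ _
    · filter_upwards [hae] with x hx
      refine Tendsto.mul_const _ (Tendsto.mul_const _ (Tendsto.inv₀ ?_ (by positivity)))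
      exact ((hx.div_const δ).pow 2).const_add 1
  have hA : Tendsto (fun n => ∫ x in Ω, (1 + ((W (ns n)).1 x / δ) ^ 2)⁻¹ *
      ⟪(W (ns n)).2 x - w.2 x, v⟫ * ψ x) atTop (𝓝 0) := by
    apply squeeze_zero_norm (a := fun n => ‖v‖ * M * ∫ x in Ω, ‖(W (ns n)).2 x - w.2 x‖)
    · intro n
      rw [← integral_const_mul]
      apply norm_integral_le_of_norm_le
      · exact ((hint _).sub (hint _)).norm.const_mul _
      · exact ae_of_all _ fun x => hbd _ _ _
    · simpa using hL1.const_mul (‖v‖ * M)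
  have hAB := hA.add hB
  rw [zero_add] at hAB
  refine le_of_tendsto hAB.abs (Eventually.of_forall fun n => ?_)
  obtain ⟨φ, hφ, hφc, hφΩ, h1, h2⟩ := hWmem (ns n)
  refine le_trans (le_of_eq ?_) (aux_ibp hΩ hφ hφc hφΩ hψ hψc hδ v)
  congr 1
  rw [← integral_add]
  · apply integral_congr_ae
    filter_upwards [h1, h2] with x hx1 hx2
    rw [hx1, hx2, inner_sub_left]
    ring
  · exact Integrable.mono' (((hint _).sub (hint _)).norm.const_mul (‖v‖ * M))
      (hmeas _ _ ((Lp.aestronglyMeasurable _).sub (Lp.aestronglyMeasurable _)))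
      (ae_of_all _ fun x => hbd _ _ _)
  · exact Integrable.mono' ((hint _).norm.const_mul (‖v‖ * M))
      (hmeas _ _ (Lp.aestronglyMeasurable _)) (ae_of_all _ fun x => hbd _ _ _)

lemma aux_grad_zero {N : ℕ} {Ω : Set (EN N)} (hΩ : MeasurableSet Ω)
    [IsFiniteMeasure (volume.restrict Ω)]
    {p : ℝ} [Fact (1 ≤ ENNReal.ofReal p)] {w : WAmbient N p Ω} (hw : w ∈ WSpace N p Ω) :
    ∀ᵐ x ∂(volume.restrict Ω), w.1 x = 0 → w.2 x = 0 := by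
  have hint : Integrable w.2 (volume.restrict Ω) := (Lp.memLp w.2).integrable Fact.out
  have hu : Measurable w.1 := (Lp.stronglyMeasurable w.1).measurable
  set S : Set (EN N) := {x | w.1 x = 0} with hS
  have hSm : MeasurableSet S := hu (measurableSet_singleton 0)
  have key : ∀ v : EN N, ∀ᵐ x ∂(volume.restrict Ω), S.indicator (fun x => ⟪w.2 x, v⟫) x = 0 := by
    intro v
    have hI : Integrable (S.indicator (fun x => ⟪w.2 x, v⟫)) (volume.restrict Ω) :=
      (hint.inner_const v).indicator hSm
    apply ae_eq_zero_of_integral_contDiff_smul_eq_zero hI.locallyIntegrable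
    intro ψ hψ hψc
    obtain ⟨M, hM⟩ := hψc.exists_bound_of_continuous hψ.continuous
    have hδ : Tendsto (fun n : ℕ => 1 / ((n : ℝ) + 1)) atTop (𝓝 0) :=
      tendsto_one_div_add_atTop_nhds_zero_nat
    have hlim : Tendsto (fun n : ℕ => ∫ x in Ω,
        (1 + (w.1 x / (1 / ((n : ℝ) + 1))) ^ 2)⁻¹ * ⟪w.2 x, v⟫ * ψ x) atTop
        (𝓝 (∫ x in Ω, ψ x • S.indicator (fun x => ⟪w.2 x, v⟫) x)) := by
      apply tendsto_integral_of_dominated_convergence (fun x => ‖v‖ * M * ‖w.2 x‖)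
      · intro n
        exact (((hu.div_const _).pow_const 2 |>.const_add 1).inv.aestronglyMeasurable.mul
          (hint.aestronglyMeasurable.inner_const)).mul hψ.continuous.aestronglyMeasurable
      · exact hint.norm.const_mul _
      · intro n
        refine ae_of_all _ fun x => ?_
        rw [norm_mul, norm_mul]
        calc _ ≤ 1 * (‖w.2 x‖ * ‖v‖) * M := by
              gcongr
              · exact aux_theta_le _ _
              · exact norm_inner_le_norm _ _
              · exact hM x
          _ = _ := by ring
      · refine ae_of_all _ fun x => ?_
        by_cases hx : w.1 x = 0
        · have : x ∈ S := hx
          simp only [hx, Set.indicator_of_mem this]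
          simp [mul_comm]
        · have : x ∉ S := hx
          simp only [Set.indicator_of_notMem this, smul_zero]
          have h0 : Tendsto (fun n : ℕ => (1 + (w.1 x / (1 / ((n : ℝ) + 1))) ^ 2)⁻¹)
              atTop (𝓝 0) := by
            apply Tendsto.inv_tendsto_atTop
            apply tendsto_atTop_add_const_left
            have h5 : Tendsto (fun n : ℕ => (n : ℝ) + 1) atTop atTop :=
              tendsto_atTop_add_const_right _ _ tendsto_natCast_atTop_atTop
            have h6 := ((tendsto_pow_atTop (α := ℝ) two_ne_zero).comp h5).const_mul_atTop
              (show 0 < (w.1 x) ^ 2 by positivity)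
            refine h6.congr fun n => ?_
            simp [mul_pow]
          simpa using (h0.mul_const ⟪w.2 x, v⟫).mul_const (ψ x)
    have hz : Tendsto (fun n : ℕ => ∫ x in Ω,
        (1 + (w.1 x / (1 / ((n : ℝ) + 1))) ^ 2)⁻¹ * ⟪w.2 x, v⟫ * ψ x) atTop (𝓝 0) := by
      apply squeeze_zero_norm (fun n => aux_limit hΩ hw hψ hψc (by positivity) v)
      simpa using hδ.mul_const ((Real.pi / 2) * ∫ x, ‖fderiv ℝ ψ x v‖)
    exact tendsto_nhds_unique hlim hz
  have key2 := ae_all_iff.2 fun i : Fin N => key (EuclideanSpace.single i 1)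
  filter_upwards [key2] with x hx h0
  ext i
  have h1 := hx i
  rw [Set.indicator_of_mem (show x ∈ S from h0)] at h1
  simpa [EuclideanSpace.inner_single_right] using h1

/-- Step (a) in the proof of Lemma 4.3, uniform version. Let
`Ω ⊂ ℝ^N` be a bounded domain, `p > 1` and `K` a compact subset of `W^{1,p}_0(Ω)`.
Then for every `ε > 0` there is `ρ_ε > 0` such that `∫_{Ω^u_{ρ_ε}} |∇u|^p dx < ε` for
all `u ∈ K`, where `Ω^u_ρ = {x ∈ Ω : |u(x)| < ρ}`. -/
theorem stmt_7 {N : ℕ} (hN : 2 ≤ N) (Ω : Set (EN N))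
    (hΩopen : IsOpen Ω) (hΩconn : IsConnected Ω) (hΩbdd : Bornology.IsBounded Ω)
    (p : ℝ) (hp : 1 < p) [Fact (1 ≤ ENNReal.ofReal p)]
    (K : Set (WAmbient N p Ω)) (hKW : K ⊆ WSpace N p Ω) (hK : IsCompact K) :
    ∀ ε > (0 : ℝ), ∃ ρ > (0 : ℝ), ∀ w ∈ K,
      ∫ x in {y ∈ Ω | |(⇑w.1 : EN N → ℝ) y| < ρ}, ‖(⇑w.2 : EN N → EN N) x‖ ^ p < ε := by
  have hp0 : 0 < p := by linarith
  haveI : IsFiniteMeasure (volume.restrict Ω) :=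
    ⟨by simpa using hΩbdd.measure_lt_top⟩
  intro ε hε
  by_contra! hcon
  choose W hWK hWε using fun n : ℕ => hcon (1 / ((n : ℝ) + 1)) (by positivity)
  obtain ⟨w, hwK, a, ha, hlim⟩ := hK.tendsto_subseq hWK
  have hl1 : Tendsto (fun n => (W (a n)).1) atTop (𝓝 w.1) := (continuous_fst.tendsto _).comp hlim
  have hl2 : Tendsto (fun n => (W (a n)).2) atTop (𝓝 w.2) := (continuous_snd.tendsto _).comp hlim
  obtain ⟨b, hb, hae⟩ := (tendstoInMeasure_of_tendsto_Lp hl1).exists_seq_tendsto_ae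
  have hLp := aux_Lp hp (hl2.comp hb.tendsto_atTop)
  have hgz := aux_grad_zero hΩopen.measurableSet (hKW hwK)
  set c : ℕ → ℕ := fun n => a (b n) with hc
  have hcm : StrictMono c := ha.comp hb
  have hI : ∀ g : Lp (EN N) (ENNReal.ofReal p) (volume.restrict Ω),
      Integrable (fun x => ‖g x‖ ^ p) (volume.restrict Ω) := by
    intro g
    have := (Lp.memLp g).integrable_norm_rpow (by simpa using hp0) (by simp)
    rwa [ENNReal.toReal_ofReal hp0.le] at this
  have hId : ∀ g h : Lp (EN N) (ENNReal.ofReal p) (volume.restrict Ω),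
      Integrable (fun x => ‖g x - h x‖ ^ p) (volume.restrict Ω) := by
    intro g h
    refine (hI (g - h)).congr ?_
    filter_upwards [Lp.coeFn_sub g h] with x hx
    rw [hx]; rfl
  set S : ℕ → Set (EN N) := fun n => {y | |(W (c n)).1 y| < 1 / ((c n : ℝ) + 1)} with hS
  have hSm : ∀ n, MeasurableSet (S n) := fun n =>
    measurableSet_lt ((Lp.stronglyMeasurable (W (c n)).1).measurable.abs) measurable_const
  have hB : Tendsto (fun n => ∫ x in Ω, (S n).indicator (fun x => ‖w.2 x‖ ^ p) x) atTop (𝓝 0) := by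
    have : (0 : ℝ) = ∫ x in Ω, (0 : ℝ) := by simp
    rw [this]
    apply tendsto_integral_of_dominated_convergence (fun x => ‖w.2 x‖ ^ p)
    · exact fun n => (hI _).aestronglyMeasurable.indicator (hSm n)
    · exact hI _
    · refine fun n => ae_of_all _ fun x => ?_
      refine (norm_indicator_le_norm_self _ _).trans (le_of_eq ?_)
      rw [Real.norm_eq_abs, abs_of_nonneg (by positivity)]
    · filter_upwards [hae, hgz] with x hx hxz
      by_cases h0 : w.1 x = 0
      · have h00 : ‖w.2 x‖ ^ p = 0 := by rw [hxz h0, norm_zero, Real.zero_rpow hp0.ne']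
        have : ∀ n, (S n).indicator (fun x => ‖w.2 x‖ ^ p) x = 0 := fun n =>
          Set.indicator_apply_eq_zero.2 fun _ => h00
        simp only [this]
        exact tendsto_const_nhds
      · have h1 : Tendsto (fun n => 1 / ((c n : ℝ) + 1)) atTop (𝓝 0) :=
          tendsto_one_div_add_atTop_nhds_zero_nat.comp hcm.tendsto_atTop
        have h2 := h1.eventually_lt hx.abs (abs_pos.2 h0)
        apply tendsto_const_nhds.congr'
        filter_upwards [h2] with n hn
        rw [Set.indicator_of_notMem]
        exact fun h => (lt_asymm hn h)
  have hle : ∀ n, ε ≤ 2 ^ (p - 1) * (∫ x in Ω, ‖(W (c n)).2 x - w.2 x‖ ^ p) +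
      2 ^ (p - 1) * ∫ x in Ω, (S n).indicator (fun x => ‖w.2 x‖ ^ p) x := by
    intro n
    refine (hWε (c n)).trans ?_
    have e : {y ∈ Ω | |(W (c n)).1 y| < 1 / ((c n : ℝ) + 1)} = S n ∩ Ω := by
      ext y; simp only [hS, Set.mem_setOf_eq, Set.mem_inter_iff]; tauto
    rw [e, ← Measure.restrict_restrict (hSm n), ← integral_indicator (hSm n),
      ← integral_const_mul, ← integral_const_mul,
      ← integral_add ((hId _ _).const_mul _) (((hI _).indicator (hSm n)).const_mul _)]
    apply integral_mono ((hI _).indicator (hSm n))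
      (((hId _ _).const_mul _).add (((hI _).indicator (hSm n)).const_mul _))
    intro x
    by_cases hx : x ∈ S n
    · simp only [Set.indicator_of_mem hx, Pi.add_apply]
      have h1 : ‖(W (c n)).2 x‖ ≤ ‖(W (c n)).2 x - w.2 x‖ + ‖w.2 x‖ := by
        simpa using norm_add_le ((W (c n)).2 x - w.2 x) (w.2 x)
      have h2 := NNReal.rpow_add_le_mul_rpow_add_rpow ‖(W (c n)).2 x - w.2 x‖₊ ‖w.2 x‖₊ hp.le
      have h3 : (‖(W (c n)).2 x - w.2 x‖ + ‖w.2 x‖) ^ p ≤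
        2 ^ (p - 1) * (‖(W (c n)).2 x - w.2 x‖ ^ p + ‖w.2 x‖ ^ p) := by exact_mod_cast h2
      calc _ ≤ _ := Real.rpow_le_rpow (norm_nonneg _) h1 hp0.le
        _ ≤ _ := h3
        _ = _ := by ring
    · simp only [Set.indicator_of_notMem hx, Pi.add_apply]
      positivity
  have hfin := (hLp.const_mul ((2 : ℝ) ^ (p - 1))).add (hB.const_mul ((2 : ℝ) ^ (p - 1)))
  have := ge_of_tendsto hfin (Eventually.of_forall hle)
  simp at this
  linarith

end
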